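/- arXiv:1707.08734 — 2 statements merged into one kernel-verified Lean document; each statement's English description precedes it below -/
import Mathlib

section
/- Let a and b be two distinct agents. For every call sequence σ in which the call ab does not occur and every formula φ of L^ck containing no occurrence of the negation symbol ¬: (M, σ) ⊨ K_a K_b K_a K_b φ if and only if M ⊨ φ, and likewise (M, σ) ⊨ K_b K_a K_b K_a φ if and only if M ⊨ φ. -/
namespace Gossip

/-- A call between two distinct agents. -/
structure Call (A : Type) where
  x : A
  y : A
  ne : x ≠ y

variable {A : Type} [DecidableEq A]

/-- Agent `a` is involved in the call `c`. -/
def Call.involves (c : Call A) (a : A) : Prop := a = c.x ∨ a = c.y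

instance (c : Call A) (a : A) : Decidable (c.involves a) := by
  unfold Call.involves; infer_instance

/-- `c` is the call between agents `a` and `b`. -/
def Call.isBetween (c : Call A) (a b : A) : Prop :=
  (c.x = a ∧ c.y = b) ∨ (c.x = b ∧ c.y = a)

instance (c : Call A) (a b : A) : Decidable (c.isBetween a b) := by
  unfold Call.isBetween; infer_instance

/-- The effect of a call on a gossip situation: the two agents involved
pool their secrets. -/
def Call.apply (c : Call A) (s : A → Finset A) : A → Finset A :=
  fun d => if d = c.x ∨ d = c.y then s c.x ∪ s c.y else s d

/-- The initial gossip situation: each agent is familiar only with their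
own secret (secrets are identified with agents via the fixed bijection). -/
def root : A → Finset A := fun a => {a}

/-- The result of applying a call sequence to a gossip situation. -/
def applySeq (σ : List (Call A)) (s : A → Finset A) : A → Finset A :=
  σ.foldl (fun t c => c.apply t) s

/-- `∼_a` : the smallest relation with `ε ∼_a ε`, closed under appending
calls not involving `a` on either side, and under appending a call
involving `a` on both sides when it yields the same set of secrets for `a`. -/
inductive AgEquiv (a : A) : List (Call A) → List (Call A) → Prop
  | nil : AgEquiv a [] []
  | extLeft {σ τ : List (Call A)} (c : Call A) :
      ¬ c.involves a → AgEquiv a σ τ → AgEquiv a (σ ++ [c]) τ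
  | extRight {σ τ : List (Call A)} (c : Call A) :
      ¬ c.involves a → AgEquiv a σ τ → AgEquiv a σ (τ ++ [c])
  | call {σ τ : List (Call A)} (c : Call A) :
      c.involves a →
      applySeq (σ ++ [c]) root a = applySeq (τ ++ [c]) root a →
      AgEquiv a σ τ → AgEquiv a (σ ++ [c]) (τ ++ [c])

/-- `∼_G` : reflexive-transitive closure of the union of the `∼_a`, `a ∈ G`. -/
def GEquiv (G : Finset A) : List (Call A) → List (Call A) → Prop :=
  Relation.ReflTransGen (fun σ τ => ∃ a ∈ G, AgEquiv a σ τ)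

/-- Formulas of the language `L^ck`. `fam a p` is `F_a p`,
`ck G φ` is `C_G φ`; `K_a φ` is `ck {a} φ`. -/
inductive Formula (A : Type) where
  | fam : A → A → Formula A
  | neg : Formula A → Formula A
  | conj : Formula A → Formula A → Formula A
  | ck : Finset A → Formula A → Formula A

/-- Truth of a formula at a call sequence (in the gossip model). -/
def Sat : Formula A → List (Call A) → Prop
  | .fam a p, σ => p ∈ applySeq σ root a
  | .neg φ, σ => ¬ Sat φ σ
  | .conj φ ψ, σ => Sat φ σ ∧ Sat ψ σ
  | .ck G φ, σ => ∀ τ, GEquiv G σ τ → Sat φ τ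

/-- `M ⊨ φ` : truth at every call sequence. -/
def Truth (φ : Formula A) : Prop := ∀ σ : List (Call A), Sat φ σ

/-- Formulas with no occurrence of the negation symbol. -/
def NegFree : Formula A → Prop
  | .fam _ _ => True
  | .neg _ => False
  | .conj φ ψ => NegFree φ ∧ NegFree ψ
  | .ck _ φ => NegFree φ

/-- Formulas with no occurrence of the `C_G` modalities (propositional part). -/
def CkFree : Formula A → Prop
  | .fam _ _ => True
  | .neg φ => CkFree φ
  | .conj φ ψ => CkFree φ ∧ CkFree ψ
  | .ck _ _ => False

/-- Formulas of `L_wn`: no nested occurrence of the `C_G` modalities. -/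
def NoNested : Formula A → Prop
  | .fam _ _ => True
  | .neg φ => NoNested φ
  | .conj φ ψ => NoNested φ ∧ NoNested ψ
  | .ck _ φ => CkFree φ

/-- The call `ab` occurs in `σ`. -/
def occursBetween (a b : A) (σ : List (Call A)) : Prop :=
  ∃ c ∈ σ, c.isBetween a b

/-- Epistemic pair-view component `Ṽ(σ)(a,b)`. -/
def pairView (σ : List (Call A)) (a b : A) : Set (A → Finset A) :=
  {s | ∃ τ, GEquiv {a, b} σ τ ∧ s = applySeq τ root}

/-- The full epistemic pair-view `Ṽ(σ)` : all components `Ṽ(σ)(a,b)`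
together with the designated situation `Ṽ(σ)(*) = σ(root)`. -/
def fullView (σ : List (Call A)) : (A → A → Set (A → Finset A)) × (A → Finset A) :=
  (pairView σ, applySeq σ root)

/-- A call sequence is pair-epistemically non-redundant if no nonempty
subsequence `σ₂` of a prefix `σ₁.σ₂` is pair-epistemically redundant. -/
def PairNonRedundant (σ : List (Call A)) : Prop :=
  ∀ σ₁ σ₂ : List (Call A), (σ₁ ++ σ₂) <+: σ → σ₂ ≠ [] →
    fullView σ₁ ≠ fullView (σ₁ ++ σ₂)

/-- Order on gossip situations: componentwise inclusion. -/
def gsLE (s t : A → Finset A) : Prop := ∀ a, s a ⊆ t a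

/-- The order `≤_EPV` on (the pair components of) epistemic pair-views. -/
def epvLE (V W : A → A → Set (A → Finset A)) : Prop :=
  ∀ a b : A, ∃ X : Set (A → Finset A), X ⊆ V a b ∧
    ∃ g : X → W a b, Function.Surjective g ∧ ∀ s : X, gsLE s.1 (g s).1

/-- `σ` is ab-redundant free: no call of `σ` different from the call `ab`
is redundant (leaves the current gossip situation unchanged). -/
def abRedundantFree (a b : A) (σ : List (Call A)) : Prop :=
  ∀ (i : ℕ) (h : i < σ.length), ¬ (σ.get ⟨i, h⟩).isBetween a b →
    (σ.get ⟨i, h⟩).apply (applySeq (σ.take i) root) ≠ applySeq (σ.take i) root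

theorem applySeq_append_singleton (σ : List (Call A)) (c : Call A) (s : A → Finset A) :
    applySeq (σ ++ [c]) s = c.apply (applySeq σ s) := by
  simp [applySeq]

theorem Call.apply_of_not_involves {c : Call A} {a : A} (h : ¬ c.involves a)
    (s : A → Finset A) : c.apply s a = s a :=
  if_neg h

theorem mem_applySeq_root (σ : List (Call A)) (a : A) : a ∈ applySeq σ root a := by
  induction σ using List.reverseRecOn with
  | nil => simp [applySeq, root]
  | append_singleton σ c ih =>
    rw [applySeq_append_singleton]
    unfold Call.apply
    split_ifs with h
    · rcases h with rfl | rfl <;> simp [ih]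
    · exact ih

theorem AgEquiv.refl (a : A) (σ : List (Call A)) : AgEquiv a σ σ := by
  induction σ using List.reverseRecOn with
  | nil => exact .nil
  | append_singleton σ c ih =>
    by_cases h : c.involves a
    · exact .call c h rfl ih
    · exact .extLeft c h (.extRight c h ih)

theorem AgEquiv.append_left {a : A} {σ τ ρ : List (Call A)} (h : AgEquiv a σ τ)
    (hρ : ∀ c ∈ ρ, ¬ c.involves a) : AgEquiv a (σ ++ ρ) τ := by
  induction ρ using List.reverseRecOn with
  | nil => simpa using h
  | append_singleton ρ c ih =>
    rw [← List.append_assoc]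
    exact .extLeft c (hρ c (by simp)) (ih fun d hd => hρ d (by simp [hd]))

theorem AgEquiv.applySeq_eq {a : A} {σ τ : List (Call A)} (h : AgEquiv a σ τ) :
    applySeq σ root a = applySeq τ root a := by
  induction h with
  | nil => rfl
  | extLeft c hc _ ih => rw [applySeq_append_singleton, Call.apply_of_not_involves hc, ih]
  | extRight c hc _ ih => rw [applySeq_append_singleton, Call.apply_of_not_involves hc, ih]
  | call c hc h _ _ => exact h

theorem AgEquiv.gEquiv {a : A} {σ τ : List (Call A)} (h : AgEquiv a σ τ) :
    GEquiv {a} σ τ :=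
  .single ⟨a, Finset.mem_singleton_self a, h⟩

theorem applySeq_root_of_not_involves {τ : List (Call A)} {a : A}
    (h : ∀ c ∈ τ, ¬ c.involves a) : applySeq τ root a = {a} :=
  (AgEquiv.append_left .nil h : AgEquiv a ([] ++ τ) []).applySeq_eq

theorem Call.exists_partner {c : Call A} {a : A} (h : c.involves a) :
    ∃ e, e ≠ a ∧ (∀ d, c.involves d ↔ d = a ∨ d = e) ∧
      ∀ s, c.apply s = fun d => if d = a ∨ d = e then s a ∪ s e else s d := by
  obtain ⟨x, y, ne⟩ := c
  rcases h with rfl | rfl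
  · exact ⟨y, ne.symm, fun d => Iff.rfl, fun s => rfl⟩
  · refine ⟨x, ne, fun d => or_comm, fun s => ?_⟩
    funext d
    simp only [Call.apply, or_comm, Finset.union_comm]

/-- A negation-free formula true at the empty call sequence is valid. -/
theorem NegFree.truth_of_sat_nil {φ : Formula A} (hφ : NegFree φ) (h : Sat φ []) :
    Truth φ := by
  induction φ with
  | fam a p =>
    intro σ
    obtain rfl : p = a := by simpa [Sat, applySeq, root] using h
    exact mem_applySeq_root σ p
  | neg φ _ => exact hφ.elim
  | conj φ ψ ih₁ ih₂ => exact fun σ => ⟨ih₁ hφ.1 h.1 σ, ih₂ hφ.2 h.2 σ⟩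
  | ck G φ ih => exact fun σ τ _ => ih hφ (h [] .refl) τ

/-- Agent `b` makes at most one call in `τ`, and not with agent `a`. -/
def AtMostOneCall (a b : A) (τ : List (Call A)) : Prop :=
  (∀ c ∈ τ, ¬ c.involves b) ∨
    ∃ ρ c ρ', τ = ρ ++ [c] ++ ρ' ∧ (∀ d ∈ ρ, ¬ d.involves b) ∧
      (∀ d ∈ ρ', ¬ d.involves b) ∧ ¬ c.involves a

theorem AtMostOneCall.append {A : Type} {a b : A} {τ : List (Call A)} (h : AtMostOneCall a b τ)
    {c : Call A} (hc : ¬ c.involves b) : AtMostOneCall a b (τ ++ [c]) := by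
  rcases h with h | ⟨ρ, d, ρ', rfl, h₁, h₂, h₃⟩
  · left
    intro d hd
    rcases List.mem_append.1 hd with hd | hd
    · exact h d hd
    · rwa [List.mem_singleton.1 hd]
  · refine .inr ⟨ρ, d, ρ' ++ [c], by simp, h₁, ?_, h₃⟩
    intro d hd
    rcases List.mem_append.1 hd with hd | hd
    · exact h₂ d hd
    · rwa [List.mem_singleton.1 hd]

/-- All calls of `τ` are between agents in `S`, who only know secrets in `S`, and `b` makes
at most one of them, not with `a`. -/
structure Confined (a b : A) (S : Finset A) (τ : List (Call A)) : Prop where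
  mem_of_involves : ∀ c ∈ τ, ∀ d, c.involves d → d ∈ S
  applySeq_subset : ∀ d ∈ S, applySeq τ root d ⊆ S
  atMostOneCall : AtMostOneCall a b τ

theorem Confined.insert {a b : A} {S : Finset A} {τ : List (Call A)}
    (h : Confined a b S τ) (n : A) : Confined a b (insert n S) τ where
  mem_of_involves c hc d hd := Finset.mem_insert_of_mem (h.mem_of_involves c hc d hd)
  applySeq_subset d hd := by
    by_cases hdS : d ∈ S
    · exact (h.applySeq_subset d hdS).trans (Finset.subset_insert n S)
    · rw [applySeq_root_of_not_involves fun c hc hcd => hdS (h.mem_of_involves c hc d hcd)]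
      simpa using hd
  atMostOneCall := h.atMostOneCall

theorem Confined.append {a b : A} {S : Finset A} {τ : List (Call A)}
    (h : Confined a b S τ) {c : Call A} (hx : c.x ∈ S) (hy : c.y ∈ S)
    (hc : AtMostOneCall a b (τ ++ [c])) : Confined a b S (τ ++ [c]) where
  mem_of_involves d hd e he := by
    rcases List.mem_append.1 hd with hd | hd
    · exact h.mem_of_involves d hd e he
    · rw [List.mem_singleton.1 hd] at he
      rcases he with rfl | rfl <;> assumption
  applySeq_subset d hd := by
    rw [applySeq_append_singleton]
    unfold Call.apply
    split_ifs
    · exact Finset.union_subset (h.applySeq_subset _ hx) (h.applySeq_subset _ hy)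
    · exact h.applySeq_subset d hd
  atMostOneCall := hc

/-- Agent `e` can collect the secrets in `N` from agents that have not made any calls. -/
theorem Confined.exists_gather {a b e : A} (hea : e ≠ a) (heb : e ≠ b) {S : Finset A}
    (haS : a ∈ S) (heS : e ∈ S) {σ τ : List (Call A)} (h : Confined a b S τ)
    (hστ : AgEquiv a σ τ) (N : Finset A) (hN : Disjoint N S) :
    ∃ τ', AgEquiv a σ τ' ∧ Confined a b (N ∪ S) τ' ∧ N ⊆ applySeq τ' root e := by
  induction N using Finset.induction_on with
  | empty => exact ⟨τ, hστ, by simpa using h, Finset.empty_subset _⟩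
  | insert n N hn ih =>
    rw [Finset.disjoint_insert_left] at hN
    obtain ⟨τ', hστ', hτ', hNe⟩ := ih hN.2
    have hnS : n ∉ N ∪ S := by simp [hn, hN.1]
    have hen : e ≠ n := fun h => hN.1 (h ▸ heS)
    have han : a ≠ n := fun h => hN.1 (h ▸ haS)
    let c : Call A := ⟨e, n, hen⟩
    have hca : ¬ c.involves a := by
      rintro (h | h)
      · exact hea h.symm
      · exact han h
    refine ⟨τ' ++ [c], .extRight c hca hστ', ?_, ?_⟩
    · rw [Finset.insert_union]
      refine (hτ'.insert n).append (by simp [c, heS]) (by simp [c]) ?_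
      by_cases hbn : b = n
      · refine .inr ⟨τ', c, [], by simp, fun d hd hdb => ?_, by simp, hca⟩
        exact hnS (hbn ▸ hτ'.mem_of_involves d hd b hdb)
      · refine hτ'.atMostOneCall.append ?_
        rintro (h | h)
        · exact heb h.symm
        · exact hbn h
    · have hce : applySeq (τ' ++ [c]) root e = applySeq τ' root e ∪ applySeq τ' root n := by
        simp [applySeq_append_singleton, Call.apply, c]
      rw [hce, Finset.insert_subset_iff]
      exact ⟨Finset.mem_union_right _ (mem_applySeq_root τ' n),
        hNe.trans Finset.subset_union_left⟩

/-- If `a` and `b` do not call each other, then `a` considers it possible that `b` made at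
most one call. -/
theorem exists_agEquiv_confined {a b : A} (hab : a ≠ b) {σ : List (Call A)}
    (h : ¬ occursBetween a b σ) :
    ∃ τ, AgEquiv a σ τ ∧ Confined a b (applySeq σ root a) τ := by
  induction σ using List.reverseRecOn with
  | nil =>
    refine ⟨[], .nil, by simp, fun d hd => ?_, .inl (by simp)⟩
    obtain rfl : d = a := by simpa [applySeq, root] using hd
    exact subset_rfl
  | append_singleton σ c ih =>
    obtain ⟨τ, hστ, hτ⟩ := ih fun ⟨d, hd, hab⟩ => h ⟨d, by simp [hd], hab⟩
    by_cases hca : c.involves a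
    · obtain ⟨e, hea, hinv, happ⟩ := Call.exists_partner hca
      have hcab : ¬ c.isBetween a b := fun hc => h ⟨c, by simp, hc⟩
      have hcb : ¬ c.involves b := by
        intro hb
        rcases hca with ha | ha <;> rcases hb with hb | hb
        · exact hab (ha.trans hb.symm)
        · exact hcab (.inl ⟨ha.symm, hb.symm⟩)
        · exact hcab (.inr ⟨hb.symm, ha.symm⟩)
        · exact hab (ha.trans hb.symm)
      have heb : e ≠ b := fun heb => hcb ((hinv b).2 (.inr heb.symm))
      have hca_apply (ρ : List (Call A)) :
          applySeq (ρ ++ [c]) root a = applySeq ρ root a ∪ applySeq ρ root e := by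
        simp [applySeq_append_singleton, happ]
      set S := applySeq σ root a with hS
      set S' := applySeq (σ ++ [c]) root a with hS'
      have haS : a ∈ S := mem_applySeq_root σ a
      have hSS' : S ⊆ S' := by
        rw [hS', hca_apply]
        exact Finset.subset_union_left
      have heS' : e ∈ S' := by
        rw [hS', hca_apply]
        exact Finset.mem_union_right _ (mem_applySeq_root σ e)
      obtain ⟨τ', hστ', hτ', hNe⟩ := (hτ.insert e).exists_gather hea heb
        (Finset.mem_insert_of_mem haS) (Finset.mem_insert_self e S) hστ
        (S' \ insert e S) Finset.sdiff_disjoint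
      rw [Finset.sdiff_union_of_subset (Finset.insert_subset heS' hSS')] at hτ'
      refine ⟨τ' ++ [c], .call c hca ?_ hστ', hτ'.append ?_ ?_ (hτ'.atMostOneCall.append hcb)⟩
      · rw [hca_apply τ', ← hστ'.applySeq_eq, ← hS, ← hS']
        refine subset_antisymm (fun p hp => ?_)
          (Finset.union_subset hSS' (hτ'.applySeq_subset e heS'))
        by_cases hpS : p ∈ S
        · exact Finset.mem_union_left _ hpS
        refine Finset.mem_union_right _ ?_
        by_cases hpe : p = e
        · exact hpe ▸ mem_applySeq_root τ' p
        · exact hNe (by simp [hp, hpS, hpe])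
      · rcases (hinv c.x).1 (.inl rfl) with hx | hx
        · exact hx ▸ hSS' haS
        · exact hx ▸ heS'
      · rcases (hinv c.y).1 (.inr rfl) with hy | hy
        · exact hy ▸ hSS' haS
        · exact hy ▸ heS'
    · refine ⟨τ, .extLeft c hca hστ, ?_⟩
      rwa [applySeq_append_singleton, Call.apply_of_not_involves hca]

theorem sat_ck_iff_truth {a b : A} (hab : a ≠ b) {σ : List (Call A)}
    (h : ¬ occursBetween a b σ) {φ : Formula A} (hφ : NegFree φ) :
    Sat (.ck {a} (.ck {b} (.ck {a} (.ck {b} φ)))) σ ↔ Truth φ := by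
  refine ⟨fun hs => hφ.truth_of_sat_nil ?_, fun ht _ _ _ _ _ _ τ _ => ht τ⟩
  obtain ⟨τ, hστ, hτ⟩ := exists_agEquiv_confined hab h
  rcases hτ.atMostOneCall with hb | ⟨ρ, c, ρ', rfl, hρ, hρ', hc⟩
  · exact hs τ hστ.gEquiv τ .refl τ .refl [] (AgEquiv.append_left .nil hb).gEquiv
  · exact hs _ hστ.gEquiv (ρ ++ [c]) ((AgEquiv.refl b _).append_left hρ').gEquiv
      ρ (AgEquiv.extLeft c hc (.refl a ρ)).gEquiv [] (AgEquiv.append_left .nil hρ).gEquiv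

theorem stmt7 {A : Type} [DecidableEq A] [Fintype A] (hA : 3 ≤ Fintype.card A)
    (a b : A) (hab : a ≠ b) (σ : List (Call A)) (h : ¬ occursBetween a b σ)
    (φ : Formula A) (hφ : NegFree φ) :
    (Sat (Formula.ck {a} (Formula.ck {b} (Formula.ck {a} (Formula.ck {b} φ)))) σ ↔ Truth φ) ∧
    (Sat (Formula.ck {b} (Formula.ck {a} (Formula.ck {b} (Formula.ck {a} φ)))) σ ↔ Truth φ) := by
  refine ⟨sat_ck_iff_truth hab h hφ, sat_ck_iff_truth hab.symm ?_ hφ⟩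
  exact fun ⟨c, hc, hcb⟩ => h ⟨c, hc, hcb.symm⟩

end Gossip
end

section
/- Let a and b be two distinct agents and σ a call sequence. The set of ab-redundant free call sequences τ such that σ ∼_{{a,b}} τ is finite. Moreover, every such τ has length at most k + |A|^{|A|}, where k is the number of occurrences of the call ab in σ. -/
namespace Gossip

variable {A : Type} [DecidableEq A]

theorem Call.subset_apply {A : Type} [DecidableEq A] (c : Call A) (s : A → Finset A) (d : A) :
    s d ⊆ c.apply s d := by
  unfold Call.apply
  split_ifs with h
  · rcases h with rfl | rfl
    · exact Finset.subset_union_left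
    · exact Finset.subset_union_right
  · exact Finset.Subset.refl _

theorem Call.sum_card_le_apply {A : Type} [DecidableEq A] [Fintype A] (c : Call A)
    (s : A → Finset A) : ∑ d, (s d).card ≤ ∑ d, (c.apply s d).card :=
  Finset.sum_le_sum fun d _ => Finset.card_le_card (c.subset_apply s d)

theorem Call.sum_card_lt_apply {A : Type} [DecidableEq A] [Fintype A] (c : Call A)
    (s : A → Finset A) (h : c.apply s ≠ s) :
    ∑ d, (s d).card < ∑ d, (c.apply s d).card := by
  obtain ⟨d, hd⟩ := Function.ne_iff.mp h
  exact Finset.sum_lt_sum (fun e _ => Finset.card_le_card (c.subset_apply s e))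
    ⟨d, Finset.mem_univ d,
      Finset.card_lt_card ((c.subset_apply s d).ssubset_of_ne (Ne.symm hd))⟩

theorem applySeq_concat {A : Type} [DecidableEq A] (σ : List (Call A)) (c : Call A)
    (s : A → Finset A) : applySeq (σ ++ [c]) s = c.apply (applySeq σ s) := by
  simp [applySeq]

theorem abRedundantFree.of_concat {A : Type} [DecidableEq A] {a b : A} {σ : List (Call A)}
    {c : Call A} (h : abRedundantFree a b (σ ++ [c])) :
    abRedundantFree a b σ ∧
      (¬ c.isBetween a b → c.apply (applySeq σ root) ≠ applySeq σ root) := by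
  constructor
  · intro i hi hc
    have key := h i (by simp; omega)
    simp only [List.get_eq_getElem, List.getElem_append_left hi,
      List.take_append_of_le_length hi.le] at key
    exact key hc
  · intro hc
    have key := h σ.length (by simp)
    simp only [List.get_eq_getElem, List.getElem_concat_length, List.take_left] at key
    exact key hc

/-- Each call other than `ab` strictly increases the total number of secrets known. -/
theorem abRedundantFree.length_le {A : Type} [DecidableEq A] [Fintype A] {a b : A}
    {τ : List (Call A)} (h : abRedundantFree a b τ) :
    τ.length ≤ τ.countP (fun c => decide (c.isBetween a b)) +
      ∑ d, (applySeq τ root d).card := by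
  induction τ using List.reverseRecOn with
  | nil => simp
  | append_singleton σ c ih =>
    obtain ⟨hσ, hc⟩ := h.of_concat
    have hlen := ih hσ
    rw [applySeq_concat, List.countP_append, List.length_append]
    by_cases hab : c.isBetween a b
    · have := c.sum_card_le_apply (applySeq σ root)
      simp [hab]
      omega
    · have := c.sum_card_lt_apply (applySeq σ root) (hc hab)
      simp [hab]
      omega

theorem Call.isBetween.involves {A : Type} {a b d : A} {c : Call A}
    (h : c.isBetween a b) (hd : d = a ∨ d = b) : c.involves d := by
  unfold Call.isBetween at h
  unfold Call.involves
  grind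

theorem AgEquiv.countP_isBetween_eq {A : Type} [DecidableEq A] {a b d : A}
    (hd : d = a ∨ d = b) {σ τ : List (Call A)} (h : AgEquiv d σ τ) :
    σ.countP (fun c => decide (c.isBetween a b)) =
      τ.countP (fun c => decide (c.isBetween a b)) := by
  induction h with
  | nil => rfl
  | extLeft c hc _ ih =>
    have : ¬ c.isBetween a b := fun h => hc (h.involves hd)
    simpa [List.countP_append, this] using ih
  | extRight c hc _ ih =>
    have : ¬ c.isBetween a b := fun h => hc (h.involves hd)
    simpa [List.countP_append, this] using ih
  | call c _ _ _ ih => simp only [List.countP_append, ih]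

theorem GEquiv.countP_isBetween_eq {A : Type} [DecidableEq A] {a b : A}
    {σ τ : List (Call A)} (h : GEquiv {a, b} σ τ) :
    σ.countP (fun c => decide (c.isBetween a b)) =
      τ.countP (fun c => decide (c.isBetween a b)) := by
  induction h with
  | refl => rfl
  | tail _ hstep ih =>
    obtain ⟨d, hd, hequiv⟩ := hstep
    exact ih.trans (hequiv.countP_isBetween_eq (by simpa using hd))

theorem sum_card_le_card_pow_card {A : Type} [Fintype A] (hA : 2 ≤ Fintype.card A)
    (s : A → Finset A) : ∑ d, (s d).card ≤ Fintype.card A ^ Fintype.card A :=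
  calc ∑ d, (s d).card ≤ ∑ _d : A, Fintype.card A :=
        Finset.sum_le_sum fun d _ => Finset.card_le_univ (s d)
    _ = Fintype.card A ^ 2 := by simp [sq]
    _ ≤ Fintype.card A ^ Fintype.card A := Nat.pow_le_pow_right (by omega) hA

instance {A : Type} [Finite A] : Finite (Call A) :=
  Finite.of_injective (fun c : Call A => (c.x, c.y)) fun c d h => by
    cases c; cases d; simpa using h

theorem stmt10 {A : Type} [DecidableEq A] [Fintype A] (hA : 3 ≤ Fintype.card A)
    (a b : A) (hab : a ≠ b) (σ : List (Call A)) :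
    {τ : List (Call A) | abRedundantFree a b τ ∧ GEquiv {a, b} σ τ}.Finite ∧
    ∀ τ : List (Call A), abRedundantFree a b τ → GEquiv {a, b} σ τ →
      τ.length ≤ σ.countP (fun c => decide (c.isBetween a b)) +
        Fintype.card A ^ Fintype.card A := by
  have bound : ∀ τ : List (Call A), abRedundantFree a b τ → GEquiv {a, b} σ τ →
      τ.length ≤ σ.countP (fun c => decide (c.isBetween a b)) +
        Fintype.card A ^ Fintype.card A := by
    intro τ hτ hequiv
    rw [hequiv.countP_isBetween_eq]
    exact hτ.length_le.trans
      (Nat.add_le_add_left (sum_card_le_card_pow_card (by omega) _) _)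
  exact ⟨(List.finite_length_le (Call A) _).subset fun τ hτ => bound τ hτ.1 hτ.2, bound⟩


end Gossip
end
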